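/- Let λ = (λ_1 ≥ λ_2 ≥ ⋯ ≥ λ_k ≥ 0) be a partition with k ≤ n parts satisfying λ_k ≥ n − k. Then G_{(λ_1−n+k, λ_2−n+k, …, λ_k−n+k)}(x_1,…,x_n|y) = Σ_{S ∈ binom([n],k)} G_{(λ_1,…,λ_k)}(x_S|y) · (∏_{j∈S̄}(1+βx_j)^k) / (∏_{i∈S}∏_{j∈S̄}(x_i − x_j)), where the left-hand side is the factorial Grothendieck polynomial in n variables indexed by the partition (λ_1−n+k, …, λ_k−n+k) padded with zeros to length n, and on the right G_{(λ_1,…,λ_k)}(x_S|y) is the factorial Grothendieck polynomial in the k variables x_S. -/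

import Mathlib

/-- `[x|y]^j = (x ⊕ y_1)⋯(x ⊕ y_j)` where `a ⊕ b = a + b + βab`; `y t` is `y_{t+1}`. -/
def fpow {F : Type*} [Field F] (β : F) (y : ℕ → F) (x : F) (j : ℕ) : F :=
  ∏ t ∈ Finset.range j, (x + y t + β * x * y t)

/-- The factorial Grothendieck polynomial, given by the Ikeda–Naruse determinantal formula
`G_λ(x|y) = det([x_i|y]^{λ_j+n−j}(1+βx_i)^{j−1})_{1≤i,j≤n} / ∏_{i<j}(x_i − x_j)`
(here `i, j : Fin n` are 0-based, so `n − j` becomes `n − 1 − j` and `j − 1` becomes `j`). -/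
noncomputable def Groth {F : Type*} [Field F] (β : F) (y : ℕ → F) {n : ℕ}
    (lam : Fin n → ℕ) (x : Fin n → F) : F :=
  (Matrix.of fun i j : Fin n =>
      fpow β y (x i) (lam j + (n - 1 - (j : ℕ))) * (1 + β * x i) ^ (j : ℕ)).det
    / ∏ i : Fin n, ∏ j ∈ Finset.Ioi i, (x i - x j)

open Finset Matrix

theorem prod_Ioi_sub_eq_det_projVandermonde {F : Type*} [Field F] (β : F) {n : ℕ} (x : Fin n → F) :
    ∏ i : Fin n, ∏ j ∈ Ioi i, (x i - x j) = (projVandermonde (fun i => 1 + β * x i) x).det := by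
  rw [det_projVandermonde]
  refine prod_congr rfl fun i _ => prod_congr rfl fun j _ => ?_
  ring

theorem prod_Ioi_sub_comp_perm {F : Type*} [Field F] {n : ℕ} (x : Fin n → F)
    (σ : Equiv.Perm (Fin n)) :
    ∏ i : Fin n, ∏ j ∈ Ioi i, (x (σ i) - x (σ j))
      = (Equiv.Perm.sign σ : ℤ) * ∏ i : Fin n, ∏ j ∈ Ioi i, (x i - x j) := by
  rw [prod_Ioi_sub_eq_det_projVandermonde 0 x, ← det_permute]
  exact prod_Ioi_sub_eq_det_projVandermonde 0 (x ∘ σ)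

theorem prod_Ioi_sub_add {F : Type*} [Field F] {k m : ℕ} (x : Fin (k + m) → F) :
    ∏ i, ∏ j ∈ Ioi i, (x i - x j)
      = (∏ i : Fin k, ∏ j ∈ Ioi i, (x (Fin.castAdd m i) - x (Fin.castAdd m j)))
        * (∏ i : Fin m, ∏ j ∈ Ioi i, (x (Fin.natAdd k i) - x (Fin.natAdd k j)))
        * ∏ i : Fin k, ∏ j : Fin m, (x (Fin.castAdd m i) - x (Fin.natAdd k j)) := by
  have key : ∀ {l : ℕ} (z : Fin l → F), ∏ i, ∏ j ∈ Ioi i, (z i - z j)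
      = ∏ i, ∏ j, if i < j then z i - z j else 1 := fun z =>
    prod_congr rfl fun i _ => by rw [← prod_filter]; congr 1; ext; simp
  have h'' (i j : Fin k) : Fin.castAdd m i < Fin.castAdd m j ↔ i < j := Iff.rfl
  rw [key, key fun i => x (Fin.castAdd m i), key fun i => x (Fin.natAdd k i), Fin.prod_univ_add]
  have h (i : Fin m) (j : Fin k) : ¬ Fin.natAdd k i < Fin.castAdd m j := by
    simp only [Fin.lt_def, Fin.val_natAdd, Fin.val_castAdd]; omega
  have h' (i : Fin k) (j : Fin m) : Fin.castAdd m i < Fin.natAdd k j := by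
    simp only [Fin.lt_def, Fin.val_natAdd, Fin.val_castAdd]; omega
  simp only [Fin.prod_univ_add, h, h', if_false, if_true, prod_const_one, one_mul, prod_mul_distrib,
    Fin.natAdd_lt_natAdd_iff, h'']
  ring

/-- Homogeneous expansion of a product of linear forms. -/
theorem exists_prod_add_mul_eq_sum {F : Type*} [Field F] (y : ℕ → F) (a : ℕ) :
    ∃ c : ℕ → F, c 0 = 1 ∧ (∀ b, a < b → c b = 0) ∧ ∀ x w : F,
      ∏ t ∈ range a, (x + y t * w) = ∑ b ∈ range (a + 1), c b * (w ^ b * x ^ (a - b)) := by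
  induction a with
  | zero => exact ⟨fun b => if b = 0 then 1 else 0, by simp, fun b hb => by simp; omega, by simp⟩
  | succ a ih =>
    obtain ⟨c, hc0, hc, h⟩ := ih
    refine ⟨fun b => c b + if b = 0 then 0 else y a * c (b - 1), by simp [hc0], fun b hb => ?_,
      fun x w => ?_⟩
    · simp [hc b (by omega), hc (b - 1) (by omega)]
    · rw [prod_range_succ, h, mul_add]
      simp only [add_mul, sum_add_distrib]
      congr 1
      · rw [sum_range_succ _ (a + 1), hc (a + 1) (by omega), zero_mul, add_zero, sum_mul]
        refine sum_congr rfl fun b hb => ?_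
        rw [Nat.sub_add_comm (by simp at hb; omega), pow_succ]
        ring
      · rw [sum_range_succ' _ (a + 1), sum_mul]
        simp only [Nat.add_eq_zero_iff, one_ne_zero, and_false, if_false, if_true, zero_mul,
          add_zero, Nat.add_sub_cancel, Nat.add_sub_add_right]
        refine sum_congr rfl fun b _ => ?_
        ring

theorem det_fpow_mul_pow {F : Type*} [Field F] (β : F) (y : ℕ → F) {m : ℕ} (x : Fin m → F) :
    (of fun i j : Fin m => fpow β y (x i) (m - 1 - (j : ℕ)) * (1 + β * x i) ^ (j : ℕ)).det
      = ∏ i : Fin m, ∏ j ∈ Ioi i, (x i - x j) := by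
  choose c hc0 hc h using exists_prod_add_mul_eq_sum y
  have hM : (of fun i j : Fin m => fpow β y (x i) (m - 1 - (j : ℕ)) * (1 + β * x i) ^ (j : ℕ))
      = projVandermonde (fun i => 1 + β * x i) x
        * of fun b j : Fin m => if j ≤ b then c (m - 1 - j) (b - j) else 0 := by
    ext i j
    have hf : fpow β y (x i) (m - 1 - (j : ℕ))
        = ∏ t ∈ range (m - 1 - j), (x i + y t * (1 + β * x i)) :=
      prod_congr rfl fun t _ => by ring
    rw [of_apply, hf, h, mul_apply, sum_mul]
    simp only [projVandermonde_apply, of_apply, mul_ite, mul_zero]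
    rw [← sum_filter]
    have hlt (b : ℕ) (hb : b ∈ range (m - 1 - j + 1)) : b + j < m := by
      have := j.2
      rw [mem_range] at hb
      omega
    refine sum_bij' (fun b hb => (⟨b + j, hlt b hb⟩ : Fin m))
      (fun (b : Fin m) _ => (b : ℕ) - j) (fun b hb => ?_) (fun b hb => ?_)
      (fun b _ => by simp) (fun b hb => ?_) (fun b hb => ?_)
    · simp only [mem_filter, mem_univ, true_and, Fin.le_def]
      exact Nat.le_add_left _ _
    · simp only [mem_filter, mem_univ, true_and, Fin.le_def] at hb
      rw [mem_range]
      omega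
    · simp only [mem_filter, mem_univ, true_and, Fin.le_def] at hb
      ext
      exact Nat.sub_add_cancel hb
    · simp only [Fin.val_rev, Nat.add_sub_cancel, pow_add]
      rw [show m - (b + j + 1) = m - 1 - j - b by omega]
      ring
  rw [hM, det_mul, det_of_isLowerTriangular (of _), prod_Ioi_sub_eq_det_projVandermonde β]
  · simp [hc0]
  · intro i j hij
    have : ¬ j ≤ i := not_le.2 hij
    simp [this]

/-- The rows in `S` in increasing order, followed by the remaining ones in increasing order. -/
noncomputable def shufflePerm {k m : ℕ} (S : {S : Finset (Fin (k + m)) // #S = k}) :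
    Equiv.Perm (Fin (k + m)) :=
  finSumFinEquiv.symm.trans
    (finSumEquivOfFinset S.2 (show #S.1ᶜ = m by rw [card_compl, S.2, Fintype.card_fin]; omega))

theorem shufflePerm_castAdd {k m : ℕ} (S : {S : Finset (Fin (k + m)) // #S = k}) (i : Fin k) :
    shufflePerm S (Fin.castAdd m i) = S.1.orderEmbOfFin S.2 i := by
  simp [shufflePerm]

theorem shufflePerm_castAdd_mem {k m : ℕ} (S : {S : Finset (Fin (k + m)) // #S = k}) (i : Fin k) :
    shufflePerm S (Fin.castAdd m i) ∈ S.1 := by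
  simp [shufflePerm]

theorem shufflePerm_natAdd_mem {k m : ℕ} (S : {S : Finset (Fin (k + m)) // #S = k}) (i : Fin m) :
    shufflePerm S (Fin.natAdd k i) ∈ S.1ᶜ := by
  simp only [shufflePerm, Equiv.trans_apply, finSumFinEquiv_symm_apply_natAdd,
    finSumEquivOfFinset_inr]
  exact orderEmbOfFin_mem _ _ _

theorem prod_shufflePerm_castAdd {F : Type*} [CommMonoid F] {k m : ℕ}
    (S : {S : Finset (Fin (k + m)) // #S = k}) (f : Fin (k + m) → F) :
    ∏ i : Fin k, f (shufflePerm S (Fin.castAdd m i)) = ∏ i ∈ S.1, f i := by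
  have h := Equiv.prod_comp (shufflePerm S) fun i => if i ∈ S.1 then f i else 1
  have h2 (i : Fin m) : shufflePerm S (Fin.natAdd k i) ∉ S.1 :=
    mem_compl.1 (shufflePerm_natAdd_mem S i)
  simpa [Fin.prod_univ_add, shufflePerm_castAdd_mem, h2] using h

theorem prod_shufflePerm_natAdd {F : Type*} [CommMonoid F] {k m : ℕ}
    (S : {S : Finset (Fin (k + m)) // #S = k}) (f : Fin (k + m) → F) :
    ∏ i : Fin m, f (shufflePerm S (Fin.natAdd k i)) = ∏ i ∈ S.1ᶜ, f i := by
  have h := Equiv.prod_comp (shufflePerm S) fun i => if i ∈ S.1ᶜ then f i else 1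
  have h2 (i : Fin k) : shufflePerm S (Fin.castAdd m i) ∉ S.1ᶜ := fun h =>
    mem_compl.1 h (shufflePerm_castAdd_mem S i)
  rw [Fin.prod_univ_add] at h
  simp only [shufflePerm_natAdd_mem, h2, if_true, if_false, prod_const_one, one_mul] at h
  rw [h, ← prod_filter, filter_mem_eq_inter, univ_inter]

/-- Laplace expansion of a determinant along its first `k` columns. -/
theorem det_eq_sum_shufflePerm {R : Type*} [CommRing R] {k m : ℕ}
    (M : Matrix (Fin (k + m)) (Fin (k + m)) R) :
    M.det = ∑ S : {S : Finset (Fin (k + m)) // #S = k}, (Equiv.Perm.sign (shufflePerm S) : ℤ) *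
      ((of fun i j : Fin k => M (shufflePerm S (Fin.castAdd m i)) (Fin.castAdd m j)).det *
        (of fun i j : Fin m => M (shufflePerm S (Fin.natAdd k i)) (Fin.natAdd k j)).det) := by
  have hblock (S : {S : Finset (Fin (k + m)) // #S = k}) :
      (of fun i j : Fin (k + m) => if i ∈ S.1 ↔ (j : ℕ) < k then M i j else 0).det =
      (Equiv.Perm.sign (shufflePerm S) : ℤ) *
      ((of fun i j : Fin k => M (shufflePerm S (Fin.castAdd m i)) (Fin.castAdd m j)).det *
        (of fun i j : Fin m => M (shufflePerm S (Fin.natAdd k i)) (Fin.natAdd k j)).det) := by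
    set N : Matrix (Fin (k + m)) (Fin (k + m)) R :=
      of fun i j => if i ∈ S.1 ↔ (j : ℕ) < k then M i j else 0 with hN
    have h1 : (N.submatrix (shufflePerm S) id).det
        = (Equiv.Perm.sign (shufflePerm S) : ℤ) * N.det := det_permute _ _
    have h2 : ((N.submatrix (shufflePerm S) id).submatrix finSumFinEquiv finSumFinEquiv)
        = fromBlocks
          (of fun i j : Fin k => M (shufflePerm S (Fin.castAdd m i)) (Fin.castAdd m j)) 0 0
          (of fun i j : Fin m => M (shufflePerm S (Fin.natAdd k i)) (Fin.natAdd k j)) := by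
      have hn (i : Fin m) : shufflePerm S (Fin.natAdd k i) ∉ S.1 :=
        mem_compl.1 (shufflePerm_natAdd_mem S i)
      ext (i | i) (j | j) <;> simp [hN, shufflePerm_castAdd_mem, hn]
    rw [← det_submatrix_equiv_self finSumFinEquiv, h2, det_fromBlocks_zero₂₁] at h1
    rw [h1, ← mul_assoc, ← Int.cast_mul, ← Units.val_mul, Int.units_mul_self]
    simp
  rw [sum_congr rfl fun S _ => (hblock S).symm]
  simp only [det_apply']
  rw [sum_comm]
  refine sum_congr rfl fun σ _ => ?_
  rw [← mul_sum]
  congr 1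
  let S₀ : {S : Finset (Fin (k + m)) // #S = k} :=
    ⟨univ.map ((Fin.castAddEmb m).trans σ.toEmbedding), by simp⟩
  have hS₀ (i) : σ i ∈ S₀.1 ↔ (i : ℕ) < k := by
    simp only [S₀, mem_map, mem_univ, true_and, Function.Embedding.trans_apply,
      Equiv.coe_toEmbedding, EmbeddingLike.apply_eq_iff_eq]
    exact ⟨by rintro ⟨a, rfl⟩; simp, fun h => ⟨⟨i, h⟩, rfl⟩⟩
  rw [Fintype.sum_eq_single S₀]
  · simp [hS₀]
  · intro S hS
    by_contra hne
    refine hS (Subtype.ext (Finset.ext fun i => ?_))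
    obtain ⟨i, rfl⟩ := σ.surjective i
    rw [hS₀]
    by_contra hi
    exact hne (prod_eq_zero (mem_univ i) (by simp [hi]))

/-- Gustafson–Milne type identity for factorial Grothendieck polynomials (the case
`λ_k ≥ n − k`):
`G_{(λ_1−n+k,…,λ_k−n+k)}(x|y) = Σ_S G_λ(x_S|y) ∏_{j∈S̄}(1+βx_j)^k / ∏_{i∈S}∏_{j∈S̄}(x_i−x_j)`. -/
theorem stmt1 {F : Type*} [Field F] (β : F) (y : ℕ → F) (n k : ℕ) (hkn : k ≤ n)
    (x : Fin n → F) (hx : Function.Injective x)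
    (lam : Fin k → ℕ) (hlam : Antitone lam) (hk : 0 < k)
    (hmin : n - k ≤ lam ⟨k - 1, Nat.sub_lt hk Nat.one_pos⟩) :
    Groth β y (fun i : Fin n => if h : (i : ℕ) < k then lam ⟨i, h⟩ - (n - k) else 0) x
      = ∑ S : {S : Finset (Fin n) // S.card = k},
          Groth β y lam (fun i : Fin k => x ((S.1.orderIsoOfFin S.2 i : Fin n)))
            * ((∏ j ∈ S.1ᶜ, (1 + β * x j) ^ k)
              / ∏ i ∈ S.1, ∏ j ∈ S.1ᶜ, (x i - x j)) := by
  obtain ⟨m, rfl⟩ := Nat.exists_eq_add_of_le hkn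
  have hle (i : Fin k) : m ≤ lam i := by
    refine le_trans (by omega) (hmin.trans (hlam ?_))
    rw [Fin.le_def]; exact Nat.le_sub_one_of_lt i.2
  have hV {l : ℕ} (z : Fin l → F) (hz : Function.Injective z) :
      ∏ i, ∏ j ∈ Ioi i, (z i - z j) ≠ 0 :=
    prod_ne_zero_iff.2 fun i _ => prod_ne_zero_iff.2 fun j hj =>
      sub_ne_zero.2 (hz.ne (mem_Ioi.1 hj).ne)
  rw [Groth, det_eq_sum_shufflePerm, sum_div]
  refine sum_congr rfl fun S _ => ?_
  set σ := shufflePerm S with hσ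
  have hA : (of fun i j : Fin k => (of fun i j : Fin (k + m) => fpow β y (x i)
        ((if h : (j : ℕ) < k then lam ⟨j, h⟩ - (k + m - k) else 0) + (k + m - 1 - (j : ℕ)))
        * (1 + β * x i) ^ (j : ℕ)) (σ (Fin.castAdd m i)) (Fin.castAdd m j))
      = of fun i j : Fin k => fpow β y (x (S.1.orderIsoOfFin S.2 i : Fin (k + m)))
        (lam j + (k - 1 - (j : ℕ))) * (1 + β * x (S.1.orderIsoOfFin S.2 i)) ^ (j : ℕ) := by
    ext i j
    have h1 := hle j
    have h2 := j.2
    simp only [of_apply, hσ, shufflePerm_castAdd, Fin.val_castAdd, h2, dif_pos, Fin.eta,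
      coe_orderIsoOfFin_apply]
    rw [show lam j - (k + m - k) + (k + m - 1 - j) = lam j + (k - 1 - j) by omega]
  have hB : (of fun i j : Fin m => (of fun i j : Fin (k + m) => fpow β y (x i)
        ((if h : (j : ℕ) < k then lam ⟨j, h⟩ - (k + m - k) else 0) + (k + m - 1 - (j : ℕ)))
        * (1 + β * x i) ^ (j : ℕ)) (σ (Fin.natAdd k i)) (Fin.natAdd k j)).det
      = (∏ j ∈ S.1ᶜ, (1 + β * x j) ^ k) * ∏ i : Fin m, ∏ j ∈ Ioi i,
          (x (σ (Fin.natAdd k i)) - x (σ (Fin.natAdd k j))) := by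
    rw [← prod_shufflePerm_natAdd, ← det_fpow_mul_pow β y fun i => x (σ (Fin.natAdd k i)),
      ← det_mul_column]
    congr 1
    ext i j
    have h2 : ¬ k + (j : ℕ) < k := by omega
    simp only [of_apply, Fin.val_natAdd, h2, dif_neg, not_false_eq_true, zero_add, pow_add]
    rw [show k + m - 1 - (k + j) = m - 1 - j by omega]
    ring
  have hcomp := prod_Ioi_sub_comp_perm x σ
  have hsplit := prod_Ioi_sub_add (x ∘ σ)
  simp only [Function.comp_apply] at hsplit
  have hcross : ∏ i : Fin k, ∏ j : Fin m, (x (σ (Fin.castAdd m i)) - x (σ (Fin.natAdd k j)))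
      = ∏ i ∈ S.1, ∏ j ∈ S.1ᶜ, (x i - x j) := by
    rw [← prod_shufflePerm_castAdd S]
    exact prod_congr rfl fun i _ => prod_shufflePerm_natAdd S fun j => x (σ (Fin.castAdd m i)) - x j
  have hsq : ((Equiv.Perm.sign σ : ℤ) : F) * (Equiv.Perm.sign σ : ℤ) = 1 := by
    rw [← Int.cast_mul, ← Units.val_mul, Int.units_mul_self]; simp
  have hVS : ∏ i : Fin k, ∏ j ∈ Ioi i, (x (σ (Fin.castAdd m i)) - x (σ (Fin.castAdd m j)))
      = ∏ i : Fin k, ∏ j ∈ Ioi i, (x (S.1.orderIsoOfFin S.2 i) - x (S.1.orderIsoOfFin S.2 j)) := by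
    simp only [hσ, shufflePerm_castAdd, coe_orderIsoOfFin_apply]
  have hne := hV x hx
  have hneσ := hV (x ∘ σ) (hx.comp σ.injective)
  simp only [Function.comp_apply] at hneσ
  rw [hA, hB, Groth]
  rw [hsplit, hcross, hVS] at hcomp hneσ
  obtain ⟨hab, hc⟩ := mul_ne_zero_iff.1 hneσ
  obtain ⟨ha, hb⟩ := mul_ne_zero_iff.1 hab
  rw [div_mul_div_comm, div_eq_div_iff hne (mul_ne_zero ha hc)]
  set D := det (of fun i j : Fin k => fpow β y (x (S.1.orderIsoOfFin S.2 i : Fin (k + m)))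
    (lam j + (k - 1 - (j : ℕ))) * (1 + β * x (S.1.orderIsoOfFin S.2 i)) ^ (j : ℕ))
  linear_combination (Equiv.Perm.sign σ : ℤ) * D * (∏ j ∈ S.1ᶜ, (1 + β * x j) ^ k) * hcomp
    + D * (∏ j ∈ S.1ᶜ, (1 + β * x j) ^ k) * (∏ i, ∏ j ∈ Ioi i, (x i - x j)) * hsq
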